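/- Let f be a holomorphic local dynamical system at 0 ∈ ℂ with multiplier a₁ = f'(0) satisfying a₁ ≠ 0 and |a₁| ≠ 1. Then f is topologically locally conjugated to the map g₍₋₎(z) = z/2 if |a₁| < 1, and to the map g₍₊₎(z) = 2z if |a₁| > 1. -/

import Mathlib

open Set Filter Topology

/-- `φ` is a homeomorphism from `W₁` onto `W₂` fixing `0` which conjugates the local dynamical
system `f₁` (defined on `U₁`) to `f₂` (defined on `U₂`). -/
def IsTopConjVia (f₁ : ℂ → ℂ) (U₁ : Set ℂ) (f₂ : ℂ → ℂ) (U₂ : Set ℂ)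
    (φ : ℂ → ℂ) (W₁ W₂ : Set ℂ) : Prop :=
  IsOpen W₁ ∧ IsOpen W₂ ∧ (0 : ℂ) ∈ W₁ ∧ (0 : ℂ) ∈ W₂ ∧ W₁ ⊆ U₁ ∧ W₂ ⊆ U₂ ∧
    ContinuousOn φ W₁ ∧ Set.BijOn φ W₁ W₂ ∧
    (∃ ψ : ℂ → ℂ, ContinuousOn ψ W₂ ∧ Set.EqOn (ψ ∘ φ) id W₁) ∧
    φ 0 = 0 ∧ ∀ z ∈ W₁, f₁ z ∈ W₁ → φ (f₁ z) = f₂ (φ z)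

/-- `f₁` and `f₂` are topologically locally conjugated at `0`. -/
def TopLocallyConj (f₁ : ℂ → ℂ) (U₁ : Set ℂ) (f₂ : ℂ → ℂ) (U₂ : Set ℂ) : Prop :=
  ∃ φ W₁ W₂, IsTopConjVia f₁ U₁ f₂ U₂ φ W₁ W₂

open Asymptotics

/-- The constants used in the proof of the attracting case of Kœnigs' theorem. -/
lemma exists_contracting_ball {f : ℂ → ℂ} {a : ℂ} (hf : AnalyticAt ℂ f 0) (hf0 : f 0 = 0)
    (hfa : deriv f 0 = a) (ha0 : a ≠ 0) (ha1 : ‖a‖ < 1) :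
    ∃ c C r : ℝ, 0 < c ∧ c < 1 ∧ c ^ 2 < ‖a‖ ∧ 0 ≤ C ∧ 0 < r ∧
      DifferentiableOn ℂ f (Metric.ball 0 r) ∧
      ∀ z ∈ Metric.ball (0 : ℂ) r, ‖f z‖ ≤ c * ‖z‖ ∧ ‖f z - a * z‖ ≤ C * ‖z‖ ^ 2 := by
  have ha : 0 < ‖a‖ := norm_pos_iff.2 ha0
  obtain ⟨c, hac, hca⟩ := exists_between
    ((Real.lt_sqrt ha.le).2 (by nlinarith : ‖a‖ ^ 2 < ‖a‖))
  have hc0 : 0 < c := ha.trans hac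
  have hc2 : c ^ 2 < ‖a‖ := (Real.lt_sqrt hc0.le).1 hca
  obtain ⟨p, hp⟩ := hf
  have hg : AnalyticAt ℂ (dslope f 0) 0 := (hp.has_fpower_series_dslope_fslope).analyticAt
  have hfg (z : ℂ) : f z = z * dslope f 0 z := by
    have := sub_smul_dslope f 0 z
    simpa [hf0] using this.symm
  have hg0 : dslope f 0 0 = a := by simp [hfa]
  obtain ⟨C, hC0, hC⟩ := hg.differentiableAt.isBigO_sub.exists_nonneg
  have h1 : ∀ᶠ z in 𝓝 (0 : ℂ), ‖dslope f 0 z‖ < c :=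
    hg.continuousAt.norm.eventually_lt_const (by simpa only [hg0] using hac)
  have h2 : ∀ᶠ z in 𝓝 (0 : ℂ), DifferentiableAt ℂ f z :=
    hp.analyticAt.eventually_analyticAt.mono fun z hz => hz.differentiableAt
  obtain ⟨r, hr, hball⟩ := Metric.eventually_nhds_iff_ball.1 (h1.and (h2.and hC.bound))
  refine ⟨c, C, r, hc0, by nlinarith, hc2, hC0, hr,
    fun z hz => (hball z hz).2.1.differentiableWithinAt, fun z hz => ?_⟩
  obtain ⟨h1, -, h3⟩ := hball z hz
  constructor
  · rw [hfg, norm_mul, mul_comm]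
    gcongr
  · rw [hg0, sub_zero] at h3
    rw [hfg, mul_comm a, ← mul_sub, norm_mul]
    calc ‖z‖ * ‖dslope f 0 z - a‖ ≤ ‖z‖ * (C * ‖z‖) := by gcongr
      _ = C * ‖z‖ ^ 2 := by ring

/-- **Kœnigs' linearization theorem**, attracting case. -/
lemma exists_linearization_of_norm_lt_one {f : ℂ → ℂ} {a : ℂ} (hf : AnalyticAt ℂ f 0)
    (hf0 : f 0 = 0) (hfa : deriv f 0 = a) (ha0 : a ≠ 0) (ha1 : ‖a‖ < 1) :
    ∃ φ : ℂ → ℂ, AnalyticAt ℂ φ 0 ∧ φ 0 = 0 ∧ deriv φ 0 = 1 ∧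
      ∀ᶠ z in 𝓝 0, φ (f z) = a * φ z := by
  obtain ⟨c, C, r, hc0, hc1, hca, hC0, hr, hfd, hb⟩ :=
    exists_contracting_ball hf hf0 hfa ha0 ha1
  have ha : 0 < ‖a‖ := norm_pos_iff.2 ha0
  set B := Metric.ball (0 : ℂ) r with hB
  have hmaps : MapsTo f B B := fun z hz => by
    have := (hb z hz).1
    rw [hB, mem_ball_zero_iff] at hz ⊢
    nlinarith [norm_nonneg z]
  have hiter (n : ℕ) : MapsTo f^[n] B B := hmaps.iterate n
  have hnorm (n : ℕ) : ∀ z ∈ B, ‖f^[n] z‖ ≤ c ^ n * ‖z‖ := by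
    induction n with
    | zero => simp
    | succ n ih =>
      intro z hz
      rw [Function.iterate_succ_apply']
      calc ‖f (f^[n] z)‖ ≤ c * ‖f^[n] z‖ := (hb _ (hiter n hz)).1
        _ ≤ c * (c ^ n * ‖z‖) := by gcongr; exact ih z hz
        _ = c ^ (n + 1) * ‖z‖ := by ring
  have hdiff (n : ℕ) : DifferentiableOn ℂ f^[n] B := by
    induction n with
    | zero => simpa using differentiableOn_id
    | succ n ih =>
      rw [Function.iterate_succ']
      exact hfd.comp ih (hiter n)
  set q : ℕ → ℂ → ℂ := fun n z => f^[n + 1] z / a ^ (n + 1) - f^[n] z / a ^ n with hq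
  have hqb (n : ℕ) (z : ℂ) (hz : z ∈ B) :
      ‖q n z‖ ≤ C / ‖a‖ * (c ^ 2 / ‖a‖) ^ n * ‖z‖ ^ 2 := by
    have h1 : q n z = (f (f^[n] z) - a * f^[n] z) / a ^ (n + 1) := by
      simp only [hq, Function.iterate_succ_apply']
      field_simp
      ring
    rw [h1, norm_div, norm_pow, div_le_iff₀ (by positivity)]
    calc ‖f (f^[n] z) - a * f^[n] z‖ ≤ C * ‖f^[n] z‖ ^ 2 := (hb _ (hiter n hz)).2
      _ ≤ C * (c ^ n * ‖z‖) ^ 2 := by gcongr; exact hnorm n z hz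
      _ = _ := by rw [div_pow]; field_simp; ring
  have hgeo : Summable fun n : ℕ => C / ‖a‖ * (c ^ 2 / ‖a‖) ^ n :=
    (summable_geometric_of_lt_one (by positivity) ((div_lt_one ha).2 hca)).mul_left _
  have hsum (z : ℂ) (hz : z ∈ B) : Summable fun n => q n z :=
    Summable.of_norm_bounded (hgeo.mul_right _) fun n => hqb n z hz
  have hlim (z : ℂ) (hz : z ∈ B) :
      Tendsto (fun n => f^[n] z / a ^ n) atTop (𝓝 (z + ∑' n, q n z)) := by
    have h := (hsum z hz).hasSum.tendsto_sum_nat.const_add z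
    refine h.congr fun n => ?_
    rw [hq, Finset.sum_range_sub (fun n => f^[n] z / a ^ n)]
    simp
  have hBnhds : B ∈ 𝓝 (0 : ℂ) := Metric.ball_mem_nhds 0 hr
  have hSd : DifferentiableOn ℂ (fun z => ∑' n, q n z) B := by
    refine Complex.differentiableOn_tsum_of_summable_norm (hgeo.mul_right (r ^ 2))
      (fun n => ((hdiff _).div_const _).sub ((hdiff _).div_const _)) Metric.isOpen_ball
      fun n z hz => (hqb n z hz).trans ?_
    have : ‖z‖ ≤ r := (mem_ball_zero_iff.1 hz).le
    gcongr
  have hSO : (fun z => ∑' n, q n z) =O[𝓝 0] fun z => ‖z - 0‖ ^ 2 := by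
    refine IsBigO.of_bound (∑' n : ℕ, C / ‖a‖ * (c ^ 2 / ‖a‖) ^ n) ?_
    filter_upwards [hBnhds] with z hz
    rw [sub_zero, norm_pow, norm_norm]
    exact tsum_of_norm_bounded (hgeo.hasSum.mul_right _) fun n => hqb n z hz
  have hSderiv : HasDerivAt (fun z => ∑' n, q n z) 0 0 := by
    simpa using! (hSO.hasFDerivAt one_lt_two (𝕜 := ℂ)).hasDerivAt
  have hS0 : ∑' n, q n 0 = 0 := by
    have (n : ℕ) : q n 0 = 0 := by
      simpa using hqb n 0 (Metric.mem_ball_self hr)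
    simp [this]
  refine ⟨fun z => z + ∑' n, q n z, ?_, by simp [hS0], ?_, ?_⟩
  · exact (differentiableOn_id.add hSd).analyticAt hBnhds
  · exact ((hasDerivAt_id' (0 : ℂ)).add hSderiv).deriv.trans (add_zero 1)
  · filter_upwards [hBnhds] with z hz
    have h1 := hlim (f z) (hmaps hz)
    have h2 := ((tendsto_add_atTop_iff_nat 1).2 (hlim z hz)).const_mul a
    refine tendsto_nhds_unique h1 (h2.congr fun n => ?_)
    rw [Function.iterate_succ_apply]
    field_simp
    ring

/-- **Kœnigs' linearization theorem**: a holomorphic germ with a hyperbolic fixed point is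
locally holomorphically conjugate to its linear part. -/
lemma exists_linearization {f : ℂ → ℂ} {a : ℂ} (hf : AnalyticAt ℂ f 0)
    (hf0 : f 0 = 0) (hfa : deriv f 0 = a) (ha0 : a ≠ 0) (ha1 : ‖a‖ ≠ 1) :
    ∃ φ : ℂ → ℂ, AnalyticAt ℂ φ 0 ∧ φ 0 = 0 ∧ deriv φ 0 = 1 ∧
      ∀ᶠ z in 𝓝 0, φ (f z) = a * φ z := by
  rcases lt_or_gt_of_ne ha1 with ha1 | ha1
  · exact exists_linearization_of_norm_lt_one hf hf0 hfa ha0 ha1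
  have hf' : deriv f 0 ≠ 0 := hfa ▸ ha0
  have hs := hf.hasStrictDerivAt
  have hgan := hf.analyticAt_localInverse hf'
  have hgd := (hs.to_localInverse hf').hasDerivAt.deriv
  have hleft := hs.eventually_left_inverse hf'
  set g := hs.localInverse _ _ _ hf'
  rw [hf0] at hgan hgd
  have hg0 : g 0 = 0 := by simpa [hf0] using hleft.self_of_nhds
  obtain ⟨φ, hφ, hφ0, hφ1, hconj⟩ := exists_linearization_of_norm_lt_one hgan hg0
    (hgd.trans (by rw [hfa])) (inv_ne_zero ha0) (by rw [norm_inv]; exact inv_lt_one_of_one_lt₀ ha1)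
  have hft : Tendsto f (𝓝 0) (𝓝 0) := by simpa [hf0] using hf.continuousAt.tendsto
  refine ⟨φ, hφ, hφ0, hφ1, ?_⟩
  filter_upwards [hleft, hft.eventually hconj] with z hz1 hz2
  rw [hz1] at hz2
  rw [hz2, mul_inv_cancel_left₀ ha0]

/-- The map `z ↦ z |z| ^ β`. -/
noncomputable def radialTwist (β : ℂ) (z : ℂ) : ℂ := z * (‖z‖ : ℂ) ^ β

@[simp]
lemma radialTwist_apply_zero (β : ℂ) : radialTwist β 0 = 0 := by simp [radialTwist]

lemma norm_radialTwist {β : ℂ} (hβ : 0 < 1 + β.re) (z : ℂ) :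
    ‖radialTwist β z‖ = ‖z‖ ^ (1 + β.re) := by
  rcases eq_or_ne z 0 with rfl | hz
  · simp [Real.zero_rpow hβ.ne']
  · have hz : 0 < ‖z‖ := norm_pos_iff.2 hz
    rw [radialTwist, norm_mul, Complex.norm_cpow_eq_rpow_re_of_pos hz, Real.rpow_add hz,
      Real.rpow_one]

lemma continuous_radialTwist {β : ℂ} (hβ : 0 < 1 + β.re) : Continuous (radialTwist β) := by
  refine continuous_iff_continuousAt.2 fun z => ?_
  rcases eq_or_ne z 0 with rfl | hz
  · rw [ContinuousAt, radialTwist_apply_zero, tendsto_zero_iff_norm_tendsto_zero]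
    simp_rw [norm_radialTwist hβ]
    have : ContinuousAt (fun z : ℂ => ‖z‖ ^ (1 + β.re)) 0 :=
      continuous_norm.continuousAt.rpow_const (Or.inr hβ.le)
    simpa [ContinuousAt, Real.zero_rpow hβ.ne'] using this
  · exact continuousAt_id.mul
      ((Complex.continuousAt_ofReal_cpow_const _ β (Or.inr (norm_ne_zero_iff.2 hz))).comp
        continuous_norm.continuousAt)

lemma radialTwist_mul (β a z : ℂ) :
    radialTwist β (a * z) = radialTwist β a * radialTwist β z := by
  simp only [radialTwist, norm_mul, Complex.ofReal_mul]
  rw [Complex.mul_cpow_ofReal_nonneg (norm_nonneg a) (norm_nonneg z)]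
  ring

lemma radialTwist_radialTwist {β γ : ℂ} (hβ : 0 < 1 + β.re)
    (h : β + (1 + β.re : ℝ) * γ = 0) (z : ℂ) : radialTwist γ (radialTwist β z) = z := by
  rcases eq_or_ne z 0 with rfl | hz
  · simp
  have hz' : (‖z‖ : ℂ) ≠ 0 := by simpa using hz
  have hlog : ((1 + β.re : ℝ) : ℂ) * Real.log ‖z‖ = Complex.log ((‖z‖ ^ (1 + β.re) : ℝ) : ℂ) := by
    rw [← Complex.ofReal_log (by positivity), Real.log_rpow (norm_pos_iff.2 hz),
      Complex.ofReal_mul]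
  have hz'' : ((‖z‖ ^ (1 + β.re) : ℝ) : ℂ) ≠ 0 :=
    Complex.ofReal_ne_zero.2 (Real.rpow_pos_of_pos (norm_pos_iff.2 hz) _).ne'
  rw [radialTwist, norm_radialTwist hβ, radialTwist, Complex.cpow_def_of_ne_zero hz',
    Complex.cpow_def_of_ne_zero hz'', ← hlog, ← Complex.ofReal_log (norm_nonneg z), mul_assoc,
    ← Complex.exp_add]
  have : Real.log ‖z‖ * β + (1 + β.re : ℝ) * Real.log ‖z‖ * γ = 0 := by
    linear_combination (Real.log ‖z‖ : ℂ) * h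
  rw [this, Complex.exp_zero, mul_one]

lemma re_inverse_exponent {β : ℂ} (hβ : 0 < 1 + β.re) :
    1 + (-β / (1 + β.re : ℝ)).re = (1 + β.re)⁻¹ := by
  rw [Complex.div_ofReal_re, Complex.neg_re]
  field_simp
  ring

/-- For `1 + Re β > 0`, the map `z ↦ z |z| ^ β` is a homeomorphism of the plane. -/
noncomputable def radialTwistHomeomorph (β : ℂ) (hβ : 0 < 1 + β.re) : ℂ ≃ₜ ℂ where
  toFun := radialTwist β
  invFun := radialTwist (-β / (1 + β.re : ℝ))
  left_inv := radialTwist_radialTwist hβ (by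
    have : ((1 + β.re : ℝ) : ℂ) ≠ 0 := Complex.ofReal_ne_zero.2 hβ.ne'
    field_simp
    ring)
  right_inv := radialTwist_radialTwist (by rw [re_inverse_exponent hβ]; positivity) (by
    have : ((1 + β.re : ℝ) : ℂ) ≠ 0 := Complex.ofReal_ne_zero.2 hβ.ne'
    rw [re_inverse_exponent hβ, Complex.ofReal_inv]
    field_simp
    ring)
  continuous_toFun := continuous_radialTwist hβ
  continuous_invFun := continuous_radialTwist (by rw [re_inverse_exponent hβ]; positivity)

/-- Two linear contractions, or two linear expansions, are topologically conjugate. -/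
lemma exists_homeomorph_conj_mul {a b : ℂ} (ha0 : a ≠ 0) (hb0 : b ≠ 0)
    (hab : 0 < Real.log ‖b‖ / Real.log ‖a‖) :
    ∃ h : ℂ ≃ₜ ℂ, h 0 = 0 ∧ ∀ z, h (a * z) = b * h z := by
  have hla : Real.log ‖a‖ ≠ 0 := fun h => by simp [h] at hab
  have hla' : (Real.log ‖a‖ : ℂ) ≠ 0 := Complex.ofReal_ne_zero.2 hla
  set β : ℂ := (Complex.log b - Complex.log a) / (Real.log ‖a‖ : ℝ) with hβdef
  have hβ : 1 + β.re = Real.log ‖b‖ / Real.log ‖a‖ := by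
    rw [hβdef, Complex.div_ofReal_re, Complex.sub_re, Complex.log_re, Complex.log_re]
    field_simp
    ring
  have hβa : radialTwist β a = b := by
    have h : (‖a‖ : ℂ) ≠ 0 := by simpa using ha0
    rw [radialTwist, Complex.cpow_def_of_ne_zero h, ← Complex.ofReal_log (norm_nonneg a), hβdef,
      mul_div_cancel₀ _ hla', Complex.exp_sub, Complex.exp_log hb0, Complex.exp_log ha0,
      mul_div_cancel₀ _ ha0]
  refine ⟨radialTwistHomeomorph β (hβ ▸ hab), radialTwist_apply_zero β, fun z => ?_⟩
  change radialTwist β (a * z) = b * radialTwist β z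
  rw [radialTwist_mul, hβa]

/-- A hyperbolic holomorphic germ is topologically conjugate to any linear map which is
contracting or expanding accordingly. -/
lemma topLocallyConj_mul {f : ℂ → ℂ} {U : Set ℂ} {a b : ℂ} (hU : U ∈ 𝓝 0)
    (hf : AnalyticAt ℂ f 0) (hf0 : f 0 = 0) (hfa : deriv f 0 = a) (ha0 : a ≠ 0) (hb0 : b ≠ 0)
    (ha1 : ‖a‖ ≠ 1) (hab : 0 < Real.log ‖b‖ / Real.log ‖a‖) :
    TopLocallyConj f U (fun z => b * z) univ := by
  obtain ⟨φ, hφ, hφ0, hφ1, hconj⟩ := exists_linearization hf hf0 hfa ha0 ha1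
  obtain ⟨h, hh0, hh⟩ := exists_homeomorph_conj_mul ha0 hb0 hab
  have hs := hφ.hasStrictDerivAt.hasStrictFDerivAt_equiv (by simp [hφ1])
  obtain ⟨V, hV, hVo, h0V⟩ := mem_nhds_iff.1 (inter_mem hU hconj)
  let e := ((hs.toOpenPartialHomeomorph φ).trans h.toOpenPartialHomeomorph).restrOpen V hVo
  have he (z : ℂ) : e z = h (φ z) := rfl
  have hsub : e.source ⊆ V := by
    simp [e]
  have h0e : (0 : ℂ) ∈ e.source := by
    simpa [e, h0V] using hs.mem_toOpenPartialHomeomorph_source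
  have he0 : e 0 = 0 := by rw [he, hφ0, hh0]
  refine ⟨e, e.source, e.target, e.open_source, e.open_target, h0e, ?_,
    fun z hz => (hV (hsub hz)).1, subset_univ _, e.continuousOn, e.bijOn,
    ⟨e.symm, e.continuousOn_symm, fun z hz => e.left_inv hz⟩, he0, fun z hz _ => ?_⟩
  · simpa [he0] using e.map_source h0e
  · have : φ (f z) = a * φ z := (hV (hsub hz)).2
    rw [he, he, this, hh]

/-- **Kœnigs' theorem, part (iii).** A one-dimensional holomorphic local dynamical system with a
hyperbolic fixed point at the origin is topologically locally conjugated to `z ↦ z/2` if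
`|a₁| < 1`, and to `z ↦ 2z` if `|a₁| > 1`. -/
theorem hyperbolic_top_normal_form
    (f : ℂ → ℂ) (U : Set ℂ) (hU : IsOpen U) (h0 : (0 : ℂ) ∈ U)
    (hf : DifferentiableOn ℂ f U) (hf0 : f 0 = 0) (hfne : ∃ z ∈ U, f z ≠ z)
    (a₁ : ℂ) (ha₁ : a₁ = deriv f 0) (ha₁0 : a₁ ≠ 0) (ha₁1 : ‖a₁‖ ≠ 1) :
    (‖a₁‖ < 1 → TopLocallyConj f U (fun z => z / 2) Set.univ) ∧
      (1 < ‖a₁‖ → TopLocallyConj f U (fun z => 2 * z) Set.univ) := by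
  have hUn : U ∈ 𝓝 (0 : ℂ) := hU.mem_nhds h0
  have hfan : AnalyticAt ℂ f 0 := hf.analyticAt hUn
  have ha : 0 < ‖a₁‖ := norm_pos_iff.2 ha₁0
  constructor
  · intro h
    have key := topLocallyConj_mul (b := 2⁻¹) hUn hfan hf0 ha₁.symm ha₁0 (by norm_num) ha₁1
      (div_pos_of_neg_of_neg (Real.log_neg (by norm_num) (by norm_num)) (Real.log_neg ha h))
    simpa only [div_eq_inv_mul] using key
  · intro h
    exact topLocallyConj_mul hUn hfan hf0 ha₁.symm ha₁0 two_ne_zero ha₁1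
      (div_pos (Real.log_pos (by norm_num)) (Real.log_pos h))
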